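/- If A is a C*-algebra, then Z(A) + J_wc(A) ⊆ CQ(A). -/

import Mathlib

open Filter Topology Pointwise

namespace CQP

variable {R : Type*} [NonUnitalRing R] [TopologicalSpace R]

/-- `I` is a closed two-sided ideal of the (C*-)algebra `S` (a subset of the ambient algebra). -/
def IsIdealOf (I S : Set R) : Prop :=
  I ⊆ S ∧ IsClosed I ∧ (0 : R) ∈ I ∧
  (∀ x ∈ I, ∀ y ∈ I, x + y ∈ I) ∧ (∀ x ∈ I, -x ∈ I) ∧
  (∀ x ∈ I, ∀ a ∈ S, a * x ∈ I ∧ x * a ∈ I)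

/-- The centre of the algebra `S`. -/
def centerOf (S : Set R) : Set R := {z ∈ S | ∀ x ∈ S, z * x = x * z}

/-- `e` is a unit for `S` relative to (modulo) the ideal `M`. -/
def IsRelUnitMod (S M : Set R) (e : R) : Prop :=
  e ∈ S ∧ ∀ x ∈ S, x - x * e ∈ M ∧ x - e * x ∈ M

/-- `M` is a modular maximal ideal of the algebra `S`. -/
def IsModMaxIdealOf (M S : Set R) : Prop :=
  IsIdealOf M S ∧ M ≠ S ∧
  (∀ I, IsIdealOf I S → M ⊆ I → I = M ∨ I = S) ∧
  ∃ e, IsRelUnitMod S M e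

/-- The algebra `S` is weakly central. -/
def WeaklyCentral (S : Set R) : Prop :=
  (∀ M, IsModMaxIdealOf M S → ¬ centerOf S ⊆ M) ∧
  (∀ M N, IsModMaxIdealOf M S → IsModMaxIdealOf N S →
    M ∩ centerOf S = N ∩ centerOf S → M = N)

/-- The algebra `S` has the centre-quotient property: every central element of a quotient
of `S` lifts to a central element of `S` modulo the ideal. -/
def HasCQ (S : Set R) : Prop :=
  ∀ I, IsIdealOf I S → ∀ a ∈ S, (∀ x ∈ S, a * x - x * a ∈ I) →
    ∃ z ∈ centerOf S, a - z ∈ I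

/-- `a` is a CQ-element of the algebra `S`. -/
def IsCQElem (S : Set R) (a : R) : Prop :=
  a ∈ S ∧ ∀ I, IsIdealOf I S → (∀ x ∈ S, a * x - x * a ∈ I) →
    ∃ z ∈ centerOf S, a - z ∈ I

/-- The set of CQ-elements of `S`. -/
def CQset (S : Set R) : Set R := {a | IsCQElem S a}

/-- The set `T_A` of modular maximal ideals witnessing the failure of weak centrality. -/
def Tset (S : Set R) : Set (Set R) :=
  {M | IsModMaxIdealOf M S ∧
    (centerOf S ⊆ M ∨ ∃ N, IsModMaxIdealOf N S ∧ N ≠ M ∧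
      ¬ centerOf S ⊆ M ∧ ¬ centerOf S ⊆ N ∧ M ∩ centerOf S = N ∩ centerOf S)}

/-- The closed two-sided ideal of `S` generated by the set `X`. -/
def genIdealOf (S X : Set R) : Set R := ⋂₀ {I | IsIdealOf I S ∧ X ⊆ I}

/-- The quotient `A/J` (of the full algebra by the ideal `J`) has the centre-quotient
property, expressed via the correspondence between ideals of `A/J` and ideals of `A`
containing `J`. -/
def HasCQmod (J : Set R) : Prop :=
  ∀ I : Set R, IsIdealOf I (Set.univ : Set R) → J ⊆ I → ∀ a : R,
    (∀ x : R, a * x - x * a ∈ I) →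
      ∃ z : R, (∀ x : R, z * x - x * z ∈ J) ∧ a - z ∈ I


end CQP

open CQP

/-- The largest weakly central ideal of the C*-algebra `S`. -/
def IsLargestWCIdealOf {R : Type*} [NonUnitalRing R] [TopologicalSpace R]
    (J S : Set R) : Prop :=
  IsIdealOf J S ∧ WeaklyCentral J ∧
    ∀ K : Set R, IsIdealOf K S → WeaklyCentral K → K ⊆ J

namespace CQP

section Ideals

variable {A : Type*} [NonUnitalCStarAlgebra A] {I : Set A}

lemma IsIdealOf.smul_mem (hI : IsIdealOf I Set.univ) (c : ℂ) {x : A} (hx : x ∈ I) :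
    c • x ∈ I := by
  let _ := CStarAlgebra.spectralOrder A
  have := CStarAlgebra.spectralOrderedRing A
  have hl := CStarAlgebra.increasingApproximateUnit A
  refine hI.2.1.mem_of_tendsto ((hl.tendsto_mul_right x).const_smul c) (.of_forall fun e => ?_)
  rw [← smul_mul_assoc]
  exact (hI.2.2.2.2.2 x hx _ (Set.mem_univ _)).1

/-- A closed two-sided ideal of a C⋆-algebra as a subspace. -/
def IsIdealOf.toSubmodule (hI : IsIdealOf I Set.univ) : Submodule ℂ A where
  carrier := I
  add_mem' hx hy := hI.2.2.2.1 _ hx _ hy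
  zero_mem' := hI.2.2.1
  smul_mem' c _ hx := hI.smul_mem c hx

lemma IsIdealOf.add_mem {S : Set A} (hI : IsIdealOf I S) {x y : A} (hx : x ∈ I) (hy : y ∈ I) :
    x + y ∈ I := hI.2.2.2.1 _ hx _ hy

lemma IsIdealOf.neg_mem {S : Set A} (hI : IsIdealOf I S) {x : A} (hx : x ∈ I) :
    -x ∈ I := hI.2.2.2.2.1 _ hx

lemma IsIdealOf.sub_mem {S : Set A} (hI : IsIdealOf I S) {x y : A} (hx : x ∈ I) (hy : y ∈ I) :
    x - y ∈ I := sub_eq_add_neg x y ▸ hI.add_mem hx (hI.neg_mem hy)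

lemma IsIdealOf.mul_left (hI : IsIdealOf I Set.univ) (a : A) {x : A} (hx : x ∈ I) :
    a * x ∈ I := (hI.2.2.2.2.2 x hx a (Set.mem_univ _)).1

lemma IsIdealOf.mul_right (hI : IsIdealOf I Set.univ) (a : A) {x : A} (hx : x ∈ I) :
    x * a ∈ I := (hI.2.2.2.2.2 x hx a (Set.mem_univ _)).2

/-- The C⋆-subalgebra `I ∩ I⋆` of a closed ideal `I`. -/
def IsIdealOf.interStar (hI : IsIdealOf I Set.univ) : NonUnitalStarSubalgebra ℂ A where
  carrier := {x | x ∈ I ∧ star x ∈ I}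
  add_mem' hx hy := ⟨hI.add_mem hx.1 hy.1, by simpa using hI.add_mem hx.2 hy.2⟩
  zero_mem' := ⟨hI.2.2.1, by simpa using hI.2.2.1⟩
  smul_mem' c _ hx := ⟨hI.smul_mem c hx.1, by simpa using hI.smul_mem _ hx.2⟩
  mul_mem' hx hy := ⟨hI.mul_left _ hy.1, by simpa using hI.mul_left _ hx.2⟩
  star_mem' hx := ⟨hx.2, by simpa using hx.1⟩

lemma IsIdealOf.isClosed_interStar (hI : IsIdealOf I Set.univ) :
    IsClosed (hI.interStar : Set A) :=
  hI.2.1.inter (hI.2.1.preimage continuous_star)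

lemma norm_sub_star_mul_self_mul_le (b y : A) (hb : ‖star b * b‖ ≤ 1) :
    ‖y - star b * b * y‖ ≤ ‖y‖ := by
  let _ := CStarAlgebra.spectralOrder A
  have := CStarAlgebra.spectralOrderedRing A
  refine CStarAlgebra.norm_sub_mul_self_le_of_inr (x := 0) y le_rfl (star_mul_self_nonneg b) hb
    (norm_nonneg y) ?_
  rw [Unitization.inr_zero, sub_zero, mul_one, ← Unitization.inr_star, ← Unitization.inr_mul,
    Unitization.norm_inr, CStarRing.norm_star_mul_self, sq]

lemma IsIdealOf.exists_norm_sub_mul_le (hI : IsIdealOf I Set.univ) {y : A} (hy : y ∈ I) {ε : ℝ}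
    (hε : 0 < ε) :
    ∃ b : A, star b * b ∈ I ∧ ‖star b * b‖ ≤ 1 ∧ ‖y - y * (star b * b)‖ ≤ ε := by
  have : IsClosed (hI.interStar : Set A) := hI.isClosed_interStar
  let _ := CStarAlgebra.spectralOrder hI.interStar
  have := CStarAlgebra.spectralOrderedRing hI.interStar
  have hl := CStarAlgebra.increasingApproximateUnit hI.interStar
  let w : hI.interStar := ⟨star y * y, hI.mul_left _ hy, by simpa using hI.mul_left _ hy⟩
  have ht := hl.tendsto_mul_left w
  have hev : ∀ᶠ e in CStarAlgebra.approximateUnit hI.interStar, ‖w * e - w‖ ≤ ε ^ 2 / 2 := by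
    filter_upwards [Metric.tendsto_nhds.1 ht (ε ^ 2 / 2) (by positivity)] with e he
    rw [dist_eq_norm] at he
    exact he.le
  obtain ⟨e, he, he0, he1⟩ := (hev.and (hl.eventually_nonneg.and hl.eventually_norm)).exists
  obtain ⟨b, rfl⟩ := CStarAlgebra.nonneg_iff_eq_star_mul_self.1 he0
  refine ⟨b, (star b * b).2.1, he1, ?_⟩
  set p : A := star (b : A) * b with hp
  have hp1 : ‖p‖ ≤ 1 := he1
  have hps : star p = p := by simp [hp]
  have hw : ‖star y * y * p - star y * y‖ ≤ ε ^ 2 / 2 := he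
  refine le_of_sq_le_sq ?_ hε.le
  rw [sq, ← CStarRing.norm_star_mul_self]
  have : star (y - y * p) * (y - y * p)
      = p * (star y * y * p - star y * y) - (star y * y * p - star y * y) := by
    simp only [star_sub, star_mul, hps]; noncomm_ring
  rw [this]
  calc _ ≤ ‖p‖ * ‖star y * y * p - star y * y‖ + ‖star y * y * p - star y * y‖ :=
        (norm_sub_le _ _).trans (by gcongr; exact norm_mul_le _ _)
    _ ≤ 1 * (ε ^ 2 / 2) + ε ^ 2 / 2 := by gcongr
    _ = ε ^ 2 := by ring

lemma IsIdealOf.star_mem (hI : IsIdealOf I Set.univ) {x : A} (hx : x ∈ I) : star x ∈ I := by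
  rw [← hI.2.1.closure_eq, Metric.mem_closure_iff]
  intro ε hε
  obtain ⟨b, hb, -, h⟩ := hI.exists_norm_sub_mul_le hx (half_pos hε)
  refine ⟨star b * b * star x, hI.mul_right _ hb, ?_⟩
  rw [dist_eq_norm, ← norm_star]
  refine lt_of_le_of_lt ?_ (half_lt_self hε)
  simpa [mul_assoc] using h

/-- The quotient of a C⋆-algebra by a closed two-sided ideal. -/
def IsIdealOf.Quotient (hI : IsIdealOf I Set.univ) : Type _ := A ⧸ hI.toSubmodule

namespace IsIdealOf.Quotient

variable (hI : IsIdealOf I Set.univ)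

noncomputable instance : NormedAddCommGroup hI.Quotient :=
  have : IsClosed (hI.toSubmodule : Set A) := hI.2.1
  inferInstanceAs (NormedAddCommGroup (A ⧸ hI.toSubmodule))

noncomputable instance : NormedSpace ℂ hI.Quotient :=
  have : IsClosed (hI.toSubmodule : Set A) := hI.2.1
  inferInstanceAs (NormedSpace ℂ (A ⧸ hI.toSubmodule))

instance : CompleteSpace hI.Quotient :=
  inferInstanceAs (CompleteSpace (A ⧸ hI.toSubmodule))

/-- The quotient map. -/
def mkL : A →ₗ[ℂ] hI.Quotient := hI.toSubmodule.mkQ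

lemma mkL_surjective : Function.Surjective (mkL hI) := hI.toSubmodule.mkQ_surjective

variable {hI} in
lemma mkL_eq_mkL {x y : A} : mkL hI x = mkL hI y ↔ x - y ∈ I :=
  Submodule.Quotient.eq _

variable {hI} in
lemma norm_mkL_le (x : A) : ‖mkL hI x‖ ≤ ‖x‖ :=
  Submodule.Quotient.norm_mk_le (S := hI.toSubmodule) x

variable {hI} in
lemma exists_norm_lt (q : hI.Quotient) {ε : ℝ} (hε : 0 < ε) :
    ∃ x, mkL hI x = q ∧ ‖x‖ < ‖q‖ + ε :=
  Submodule.Quotient.norm_mk_lt (S := hI.toSubmodule) q hε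

instance : Mul hI.Quotient where
  mul := Quotient.map₂ (· * ·) fun a b hab c d hcd => by
    have hab : a - b ∈ I := (Submodule.quotientRel_def _).1 hab
    have hcd : c - d ∈ I := (Submodule.quotientRel_def _).1 hcd
    refine (Submodule.quotientRel_def _).2 ?_
    show a * c - b * d ∈ I
    have : a * c - b * d = (a - b) * c + b * (c - d) := by noncomm_ring
    exact this ▸ hI.add_mem (hI.mul_right _ hab) (hI.mul_left _ hcd)

instance : Star hI.Quotient where
  star := Quotient.map star fun a b hab => by
    have hab : a - b ∈ I := (Submodule.quotientRel_def _).1 hab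
    refine (Submodule.quotientRel_def _).2 ?_
    show star a - star b ∈ I
    simpa using hI.star_mem hab

lemma mkL_mul (x y : A) : mkL hI (x * y) = mkL hI x * mkL hI y := rfl

lemma mkL_star (x : A) : mkL hI (star x) = star (mkL hI x) := rfl

noncomputable instance : NonUnitalNormedRing hI.Quotient where
  __ := (inferInstance : NormedAddCommGroup hI.Quotient)
  left_distrib := (mkL_surjective hI).forall₃.2 fun x y z => by
    simp only [← map_add, ← mkL_mul, mul_add]
  right_distrib := (mkL_surjective hI).forall₃.2 fun x y z => by
    simp only [← map_add, ← mkL_mul, add_mul]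
  zero_mul := (mkL_surjective hI).forall.2 fun x => by
    rw [← map_zero (mkL hI), ← mkL_mul, zero_mul]
  mul_zero := (mkL_surjective hI).forall.2 fun x => by
    rw [← map_zero (mkL hI), ← mkL_mul, mul_zero]
  mul_assoc := (mkL_surjective hI).forall₃.2 fun x y z => by
    simp only [← mkL_mul, mul_assoc]
  norm_mul_le p q := by
    have key : ∀ ε > 0, ‖p * q‖ ≤ (‖p‖ + ε) * (‖q‖ + ε) := fun ε hε => by
      obtain ⟨x, rfl, hx⟩ := exists_norm_lt p hε
      obtain ⟨y, rfl, hy⟩ := exists_norm_lt q hε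
      rw [← mkL_mul]
      exact (norm_mkL_le _).trans ((norm_mul_le _ _).trans (by gcongr))
    have ht : Tendsto (fun ε : ℝ => (‖p‖ + ε) * (‖q‖ + ε)) (𝓝[>] 0) (𝓝 (‖p‖ * ‖q‖)) := by
      have : Continuous fun ε : ℝ => (‖p‖ + ε) * (‖q‖ + ε) := by fun_prop
      simpa using (this.tendsto 0).mono_left nhdsWithin_le_nhds
    exact ge_of_tendsto ht (eventually_nhdsWithin_of_forall key)

instance : StarRing hI.Quotient where
  star_involutive := (mkL_surjective hI).forall.2 fun x => by
    rw [← mkL_star, ← mkL_star, star_star]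
  star_mul := (mkL_surjective hI).forall₂.2 fun x y => by
    simp only [← mkL_star, ← mkL_mul, star_mul]
  star_add := (mkL_surjective hI).forall₂.2 fun x y => by
    simp only [← mkL_star, ← map_add, star_add]

lemma norm_mkL_mul_self_le (x : A) : ‖mkL hI x‖ * ‖mkL hI x‖ ≤ ‖star (mkL hI x) * mkL hI x‖ := by
  refine le_of_forall_pos_le_add fun ε hε => ?_
  obtain ⟨v, hv, hvn⟩ := exists_norm_lt (star (mkL hI x) * mkL hI x) (half_pos hε)
  rw [← mkL_star, ← mkL_mul, mkL_eq_mkL] at hv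
  rw [← mkL_star, ← mkL_mul] at hvn ⊢
  obtain ⟨b, hb, hb1, hbn⟩ := hI.exists_norm_sub_mul_le hv (half_pos hε)
  set p : A := star b * b with hp
  have hps : star p = p := by simp [hp]
  have h1 : mkL hI x = mkL hI (x - x * p) := by
    rw [mkL_eq_mkL]; simpa using hI.mul_left x hb
  have h2 : star (x - x * p) * (x - x * p)
      = (star x * x - star x * x * p) - p * (star x * x - star x * x * p) := by
    simp only [star_sub, star_mul, hps]; noncomm_ring
  have h3 : ‖v - v * p‖ ≤ ‖v‖ := by
    rw [← norm_star]
    have := norm_sub_star_mul_self_mul_le b (star v) hb1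
    rw [norm_star] at this
    simpa [hps, hp] using this
  calc ‖mkL hI x‖ * ‖mkL hI x‖ ≤ ‖x - x * p‖ * ‖x - x * p‖ := by
        rw [h1]; gcongr <;> exact norm_mkL_le _
    _ = ‖(star x * x - star x * x * p) - p * (star x * x - star x * x * p)‖ := by
        rw [← CStarRing.norm_star_mul_self, h2]
    _ ≤ ‖star x * x - star x * x * p‖ := norm_sub_star_mul_self_mul_le b _ hb1
    _ = ‖(v - v * p) - ((v - star x * x) - (v - star x * x) * p)‖ := by
        congr 1; noncomm_ring
    _ ≤ ‖v - v * p‖ + ‖(v - star x * x) - (v - star x * x) * p‖ := norm_sub_le _ _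
    _ ≤ ‖mkL hI (star x * x)‖ + ε := by linarith

noncomputable instance : NonUnitalCStarAlgebra hI.Quotient where
  norm_mul_self_le := (mkL_surjective hI).forall.2 (norm_mkL_mul_self_le hI)
  smul_assoc c := (mkL_surjective hI).forall₂.2 fun x y => by
    simp only [← map_smul, smul_eq_mul, ← mkL_mul, smul_mul_assoc]
  smul_comm c := (mkL_surjective hI).forall₂.2 fun x y => by
    simp only [← map_smul, smul_eq_mul, ← mkL_mul, mul_smul_comm]
  star_smul c := (mkL_surjective hI).forall.2 fun x => by
    simp only [← map_smul, ← mkL_star, star_smul]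

/-- The quotient map as a star homomorphism. -/
noncomputable def mk : A →⋆ₙₐ[ℂ] hI.Quotient where
  toFun := mkL hI
  map_smul' := map_smul (mkL hI)
  map_zero' := map_zero _
  map_add' := map_add _
  map_mul' := mkL_mul hI
  map_star' := mkL_star hI

lemma mk_surjective : Function.Surjective (mk hI) := mkL_surjective hI

variable {hI} in
lemma mk_eq_zero {x : A} : mk hI x = 0 ↔ x ∈ I := by
  rw [← map_zero (mk hI)]
  exact mkL_eq_mkL.trans (by simp)

variable {hI} in
lemma norm_mk_le (x : A) : ‖mk hI x‖ ≤ ‖x‖ := norm_mkL_le x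

lemma continuous_mk : Continuous (mk hI) :=
  AddMonoidHomClass.continuous_of_bound (mk hI) 1 fun x => by simpa using norm_mk_le x

end IsIdealOf.Quotient

end Ideals
end CQP
namespace CQP

lemma isIdealOf_preimage_zero {A B : Type*} [NonUnitalCStarAlgebra A] [NonUnitalCStarAlgebra B]
    (f : A →⋆ₙₐ[ℂ] B) (hf : Continuous f) : IsIdealOf (f ⁻¹' {0}) Set.univ := by
  refine ⟨Set.subset_univ _, isClosed_singleton.preimage hf, by simp, ?_, ?_, ?_⟩ <;>
    simp +contextual

/-- The range of a star homomorphism between C⋆-algebras is closed. -/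
lemma isClosed_range_starHom {A B : Type*} [NonUnitalCStarAlgebra A] [NonUnitalCStarAlgebra B]
    (f : A →⋆ₙₐ[ℂ] B) (hf : Continuous f) : IsClosed (Set.range f) := by
  have hI := isIdealOf_preimage_zero f hf
  let g₀ : hI.Quotient →ₗ[ℂ] B := hI.toSubmodule.liftQ (f : A →ₗ[ℂ] B) fun x hx => hx
  have hg₀ (x : A) : g₀ (IsIdealOf.Quotient.mk hI x) = f x := rfl
  let g : hI.Quotient →⋆ₙₐ[ℂ] B :=
    { toFun := g₀
      map_smul' := map_smul g₀
      map_zero' := map_zero g₀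
      map_add' := map_add g₀
      map_mul' := (IsIdealOf.Quotient.mk_surjective hI).forall₂.2 fun x y => by
        rw [← map_mul, hg₀, hg₀, hg₀, map_mul]
      map_star' := (IsIdealOf.Quotient.mk_surjective hI).forall.2 fun x => by
        rw [← map_star, hg₀, hg₀, map_star] }
  have hg (x : A) : g (IsIdealOf.Quotient.mk hI x) = f x := rfl
  have hinj : Function.Injective g := by
    refine (injective_iff_map_eq_zero g).2 ((IsIdealOf.Quotient.mk_surjective hI).forall.2 ?_)
    intro x hx
    exact IsIdealOf.Quotient.mk_eq_zero.2 (by simpa [hg] using hx)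
  have hr : Set.range f = Set.range g := by
    ext b
    constructor
    · rintro ⟨x, rfl⟩; exact ⟨_, hg x⟩
    · rintro ⟨q, rfl⟩
      obtain ⟨x, rfl⟩ := IsIdealOf.Quotient.mk_surjective hI q
      exact ⟨x, (hg x).symm⟩
  rw [hr]
  exact (NonUnitalStarAlgHom.isometry g hinj).isClosedEmbedding.isClosed_range

section ModularMaximal

variable {A : Type*} [NonUnitalCStarAlgebra A]

lemma IsRelUnitMod.mono {S M N : Set A} {e : A} (he : IsRelUnitMod S M e) (h : M ⊆ N) :
    IsRelUnitMod S N e :=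
  ⟨he.1, fun x hx => ⟨h (he.2 x hx).1, h (he.2 x hx).2⟩⟩

/-- A proper closed ideal stays at distance at least one from each of its relative units. -/
lemma IsIdealOf.one_le_norm_sub {K : Set A} (hK : IsIdealOf K Set.univ) {e : A}
    (he : IsRelUnitMod Set.univ K e) (heK : e ∉ K) {x : A} (hx : x ∈ K) : 1 ≤ ‖e - x‖ := by
  by_contra! hlt
  apply heK
  have hpow (n : ℕ) : ∃ y ∈ K, ‖e - y‖ ≤ ‖e - x‖ ^ (n + 1) := by
    induction n with
    | zero => exact ⟨x, hx, by simp⟩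
    | succ n ih =>
      obtain ⟨y, hy, hn⟩ := ih
      refine ⟨(e - e * e) + (y * (e - x) + e * x), ?_, ?_⟩
      · exact hK.add_mem (he.2 e (Set.mem_univ _)).1
          (hK.add_mem (hK.mul_right _ hy) (hK.mul_left _ hx))
      · have : e - ((e - e * e) + (y * (e - x) + e * x)) = (e - y) * (e - x) := by noncomm_ring
        rw [this, pow_succ]
        exact (norm_mul_le _ _).trans (by gcongr)
  rw [← hK.2.1.closure_eq, Metric.mem_closure_iff]
  intro ε hε
  obtain ⟨n, hn⟩ := exists_pow_lt_of_lt_one hε hlt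
  obtain ⟨y, hy, hyn⟩ := hpow n
  refine ⟨y, hy, ?_⟩
  rw [dist_eq_norm]
  exact (hyn.trans (pow_le_pow_of_le_one (norm_nonneg _) hlt.le n.le_succ)).trans_lt hn

lemma IsIdealOf.eq_univ_of_relUnit_mem {K : Set A} (hK : IsIdealOf K Set.univ) {e : A}
    (he : IsRelUnitMod Set.univ K e) (heK : e ∈ K) : K = Set.univ := by
  refine Set.eq_univ_of_forall fun x => ?_
  simpa using hK.add_mem (he.2 x (Set.mem_univ _)).1 (hK.mul_left x heK)

lemma isIdealOf_closure {S : Set A} (h0 : (0 : A) ∈ S) (hadd : ∀ x ∈ S, ∀ y ∈ S, x + y ∈ S)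
    (hneg : ∀ x ∈ S, -x ∈ S) (hmul : ∀ x ∈ S, ∀ a, a * x ∈ S ∧ x * a ∈ S) :
    IsIdealOf (closure S) Set.univ := by
  refine ⟨Set.subset_univ _, isClosed_closure, subset_closure h0, ?_, ?_, ?_⟩
  · exact fun x hx y hy => map_mem_closure₂ continuous_add hx hy hadd
  · exact fun x hx => map_mem_closure continuous_neg hx hneg
  · refine fun x hx a _ => ⟨?_, ?_⟩
    · exact map_mem_closure (f := fun y => a * y) (by fun_prop) hx fun y hy => (hmul y hy a).1
    · exact map_mem_closure (f := fun y => y * a) (by fun_prop) hx fun y hy => (hmul y hy a).2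

/-- A proper modular closed ideal is contained in a modular maximal ideal. -/
lemma IsIdealOf.exists_le_modMax {K : Set A} (hK : IsIdealOf K Set.univ) {e : A}
    (he : IsRelUnitMod Set.univ K e) (heK : e ∉ K) :
    ∃ M, IsModMaxIdealOf M Set.univ ∧ K ⊆ M ∧ e ∉ M := by
  let P : Set (Set A) := {L | IsIdealOf L Set.univ ∧ K ⊆ L ∧ e ∉ L}
  obtain ⟨M, hKM, hM⟩ := zorn_subset_nonempty P (fun c hcP hc ⟨L₀, hL₀⟩ => by
    refine ⟨closure (⋃₀ c), ⟨isIdealOf_closure ?_ ?_ ?_ ?_, ?_, ?_⟩, fun s hs =>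
      (Set.subset_sUnion_of_mem hs).trans subset_closure⟩
    · exact ⟨L₀, hL₀, (hcP hL₀).1.2.2.1⟩
    · rintro x ⟨L, hL, hx⟩ y ⟨L', hL', hy⟩
      obtain h | h := hc.total hL hL'
      · exact ⟨L', hL', (hcP hL').1.add_mem (h hx) hy⟩
      · exact ⟨L, hL, (hcP hL).1.add_mem hx (h hy)⟩
    · rintro x ⟨L, hL, hx⟩
      exact ⟨L, hL, (hcP hL).1.neg_mem hx⟩
    · rintro x ⟨L, hL, hx⟩ a
      exact ⟨⟨L, hL, (hcP hL).1.mul_left a hx⟩, ⟨L, hL, (hcP hL).1.mul_right a hx⟩⟩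
    · exact (hcP hL₀).2.1.trans ((Set.subset_sUnion_of_mem hL₀).trans subset_closure)
    · rw [Metric.mem_closure_iff]
      push Not
      refine ⟨1, one_pos, ?_⟩
      rintro x ⟨L, hL, hx⟩
      rw [dist_eq_norm]
      exact (hcP hL).1.one_le_norm_sub (he.mono (hcP hL).2.1) (hcP hL).2.2 hx)
    K ⟨hK, subset_rfl, heK⟩
  refine ⟨M, ⟨hM.prop.1, ?_, ?_, e, he.mono hKM⟩, hKM, hM.prop.2.2⟩
  · rintro rfl
    exact hM.prop.2.2 (Set.mem_univ _)
  · intro I hI hMI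
    by_cases heI : e ∈ I
    · exact .inr (hI.eq_univ_of_relUnit_mem (he.mono (hKM.trans hMI)) heI)
    · exact .inl (hM.eq_of_subset ⟨hI, hKM.trans hMI, heI⟩ hMI).symm

end ModularMaximal

section Commutative

variable {C : Type*} [NonUnitalCommCStarAlgebra C]

open WeakDual Unitization

lemma norm_character_inr_le (φ : characterSpace ℂ (Unitization ℂ C)) (c : C) :
    ‖φ (c : Unitization ℂ C)‖ ≤ ‖c‖ := by
  rw [← norm_inr (𝕜 := ℂ) (a := c), ← gelfandTransform_isometry _ |>.norm_map_of_map_zero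
    (map_zero _) (c : Unitization ℂ C)]
  exact ContinuousMap.norm_coe_le_norm (gelfandTransform ℂ (Unitization ℂ C) c) φ

/-- The character of the unitization vanishing on the original algebra. -/
noncomputable def characterAtInfty : characterSpace ℂ (Unitization ℂ C) :=
  CharacterSpace.equivAlgHom.symm (Unitization.fstHom ℂ C)

lemma characterAtInfty_apply (x : Unitization ℂ C) : characterAtInfty x = x.fst := rfl

lemma exists_localizer (φ : characterSpace ℂ (Unitization ℂ C)) {c n : C}
    (hc : φ (c : Unitization ℂ C) ≠ 0) (hn : φ (n : Unitization ℂ C) = 0) {ε : ℝ} (hε : 0 < ε) :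
    ∃ f : C, φ (f : Unitization ℂ C) = 1 ∧ ‖f‖ ≤ 1 ∧ ‖f * n‖ ≤ ε := by
  let X := characterSpace ℂ (Unitization ℂ C)
  let Γ := gelfandStarTransform (Unitization ℂ C)
  have hΓ (x : Unitization ℂ C) (ψ : X) : Γ x ψ = ψ x := rfl
  have hΓn (x : Unitization ℂ C) : ‖Γ x‖ = ‖x‖ :=
    (gelfandTransform_isometry _).norm_map_of_map_zero (map_zero _) x
  let F : Set X := {ψ | ε ≤ ‖Γ n ψ‖} ∪ {characterAtInfty}
  have hF : IsClosed F :=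
    (isClosed_le continuous_const (Γ n).continuous.norm).union isClosed_singleton
  have hφF : φ ∉ F := by
    rintro (h | h)
    · simp only [Set.mem_ofPred_eq, hΓ, hn, norm_zero] at h
      exact h.not_gt hε
    · rw [Set.mem_singleton_iff] at h
      rw [h, characterAtInfty_apply, fst_inr] at hc
      exact hc rfl
  obtain ⟨u, hu0, hu1, hu⟩ := exists_continuous_zero_one_of_isClosed hF
    (isClosed_singleton (x := φ)) (Set.disjoint_singleton_right.2 hφF)
  let v : C(X, ℂ) := ⟨fun ψ => (u ψ : ℂ), by fun_prop⟩
  obtain ⟨d, hd : Γ d = v⟩ := Γ.surjective v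
  have hdψ (ψ : X) : ψ d = (u ψ : ℂ) := by rw [← hΓ, hd]; rfl
  have hd0 : d.fst = 0 := by
    rw [← characterAtInfty_apply, hdψ, hu0 (Or.inr rfl)]; simp
  have hdf : (d.snd : Unitization ℂ C) = d := by
    ext <;> simp [hd0]
  refine ⟨d.snd, ?_, ?_, ?_⟩
  · rw [hdf, hdψ, hu1 rfl]; simp
  · rw [← norm_inr (𝕜 := ℂ), hdf, ← hΓn, hd]
    refine (ContinuousMap.norm_le _ zero_le_one).2 fun ψ => ?_
    have := hu ψ
    show ‖(u ψ : ℂ)‖ ≤ 1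
    rw [Complex.norm_real, Real.norm_eq_abs, abs_of_nonneg this.1]
    exact this.2
  · rw [← norm_inr (𝕜 := ℂ), inr_mul, hdf, ← hΓn, map_mul, hd]
    refine (ContinuousMap.norm_le _ hε.le).2 fun ψ => ?_
    rw [ContinuousMap.mul_apply, norm_mul]
    show ‖(u ψ : ℂ)‖ * _ ≤ ε
    rw [Complex.norm_real, Real.norm_eq_abs, abs_of_nonneg (hu ψ).1]
    by_cases hψ : ε ≤ ‖Γ n ψ‖
    · rw [hu0 (Or.inl hψ)]; simpa using hε.le
    · calc _ ≤ 1 * ‖Γ n ψ‖ := by gcongr; exact (hu ψ).2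
        _ ≤ ε := by rw [one_mul]; exact (not_le.1 hψ).le

/-- Stone–Weierstrass for closed star subalgebras of a commutative C⋆-algebra. -/
lemma eq_top_of_separates (B : NonUnitalStarSubalgebra ℂ C) (hB : IsClosed (B : Set C))
    (hne : ∀ φ : characterSpace ℂ (Unitization ℂ C), φ ≠ characterAtInfty →
      ∃ b ∈ B, φ (b : Unitization ℂ C) ≠ 0)
    (hsep : ∀ φ ψ : characterSpace ℂ (Unitization ℂ C), φ ≠ characterAtInfty →
      ψ ≠ characterAtInfty → φ ≠ ψ →
      ∃ b ∈ B, φ (b : Unitization ℂ C) ≠ ψ (b : Unitization ℂ C)) (c : C) : c ∈ B := by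
  let X := characterSpace ℂ (Unitization ℂ C)
  let Γ := gelfandStarTransform (Unitization ℂ C)
  have hΓ (x : Unitization ℂ C) (ψ : X) : Γ x ψ = ψ x := rfl
  let D : StarSubalgebra ℂ (Unitization ℂ C) :=
    { carrier := {d | d.snd ∈ B}
      mul_mem' := fun {x y} hx hy => by
        simp only [Set.mem_ofPred_eq, snd_mul] at *
        exact add_mem (add_mem (SMulMemClass.smul_mem _ hy) (SMulMemClass.smul_mem _ hx)) (mul_mem hx hy)
      add_mem' := fun {x y} hx hy => by
        simp only [Set.mem_ofPred_eq, snd_add] at *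
        exact add_mem hx hy
      algebraMap_mem' := fun r => by
        simp [algebraMap_eq_inl]
      star_mem' := fun {x} hx => by
        simp only [Set.mem_ofPred_eq] at *
        exact star_mem (s := B) hx }
  have hmem {d : Unitization ℂ C} : d ∈ D ↔ d.snd ∈ B := Iff.rfl
  have hsepD : (D.map (Γ : Unitization ℂ C →⋆ₐ[ℂ] C(X, ℂ))).SeparatesPoints := by
    have key : ∀ φ ψ : X, φ ≠ ψ → ∃ b ∈ B, φ (b : Unitization ℂ C) ≠ ψ (b : Unitization ℂ C) := by
      intro φ ψ h
      by_cases h1 : φ = characterAtInfty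
      · subst h1
        obtain ⟨b, hb, hb'⟩ := hne ψ h.symm
        exact ⟨b, hb, by rw [characterAtInfty_apply, fst_inr]; exact hb'.symm⟩
      by_cases h2 : ψ = characterAtInfty
      · subst h2
        obtain ⟨b, hb, hb'⟩ := hne φ h
        exact ⟨b, hb, by rw [characterAtInfty_apply, fst_inr]; exact hb'⟩
      exact hsep φ ψ h1 h2 h
    intro φ ψ h
    obtain ⟨b, hb, hb'⟩ := key φ ψ h
    exact ⟨_, ⟨Γ b, ⟨b, by simpa [hmem] using hb, rfl⟩, rfl⟩, hb'⟩
  have htop := ContinuousMap.starSubalgebra_topologicalClosure_eq_top_of_separatesPoints _ hsepD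
  have hcl : (c : Unitization ℂ C) ∈ closure (D : Set (Unitization ℂ C)) := by
    have h1 : Γ (c : Unitization ℂ C) ∈
        closure ((D.map (Γ : Unitization ℂ C →⋆ₐ[ℂ] C(X, ℂ)) : Set C(X, ℂ))) := by
      rw [← StarSubalgebra.topologicalClosure_coe, htop]
      trivial
    have hind := (gelfandTransform_isometry (Unitization ℂ C)).isUniformInducing.isInducing
    rw [hind.closure_eq_preimage_closure_image]
    exact h1
  have hsnd : Continuous (fun d : Unitization ℂ C => d.snd) :=
    continuous_snd.comp (uniformEquivProd (𝕜 := ℂ) (A := C)).continuous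
  have := map_mem_closure (t := (B : Set C)) hsnd hcl fun d hd => hd
  rwa [hB.closure_eq] at this

end Commutative

end CQP
namespace CQP

section WeaklyCentral

variable {A : Type*} [NonUnitalCStarAlgebra A]

open WeakDual Unitization

lemma isClosed_center (A : Type*) [NonUnitalCStarAlgebra A] :
    IsClosed (NonUnitalStarSubalgebra.center ℂ A : Set A) := by
  have : (NonUnitalStarSubalgebra.center ℂ A : Set A) = ⋂ b : A, {a | b * a = a * b} := by
    ext a
    simp [← NonUnitalStarSubalgebra.mem_center_iff (R := ℂ)]
  rw [this]
  exact isClosed_iInter fun b => isClosed_eq (by fun_prop) (by fun_prop)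

noncomputable instance : NonUnitalCommCStarAlgebra (NonUnitalStarSubalgebra.center ℂ A) :=
  have := isClosed_center A
  { NonUnitalStarSubalgebra.nonUnitalCStarAlgebra (NonUnitalStarSubalgebra.center ℂ A) with
    mul_comm := fun x y => Subtype.ext (NonUnitalStarSubalgebra.mem_center_iff.1 y.2 x) }

lemma mem_centerOf_univ {a : A} :
    a ∈ centerOf (Set.univ : Set A) ↔ a ∈ NonUnitalStarSubalgebra.center ℂ A := by
  rw [NonUnitalStarSubalgebra.mem_center_iff]
  exact ⟨fun h b => (h.2 b (Set.mem_univ b)).symm, fun h => ⟨Set.mem_univ a, fun b _ => (h b).symm⟩⟩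

lemma character_apply {C : Type*} [NonUnitalCommCStarAlgebra C]
    (φ : characterSpace ℂ (Unitization ℂ C)) (d : Unitization ℂ C) :
    φ d = d.fst + φ (d.snd : Unitization ℂ C) := by
  conv_lhs => rw [← inl_fst_add_inr_snd_eq d, map_add]
  rw [← algebraMap_eq_inl, AlgHomClass.commutes]
  rfl

lemma character_inr_sub {C : Type*} [NonUnitalCommCStarAlgebra C]
    (φ : characterSpace ℂ (Unitization ℂ C)) (x y : C) :
    φ ((x - y : C) : Unitization ℂ C) = φ (x : Unitization ℂ C) - φ (y : Unitization ℂ C) := by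
  rw [inr_sub, map_sub]

lemma exists_character_ne_zero {C : Type*} [NonUnitalCommCStarAlgebra C]
    {φ : characterSpace ℂ (Unitization ℂ C)} (hφ : φ ≠ characterAtInfty) :
    ∃ c : C, φ (c : Unitization ℂ C) ≠ 0 := by
  by_contra! h
  refine hφ (DFunLike.ext _ _ fun d => ?_)
  rw [character_apply, h, add_zero, characterAtInfty_apply]

variable {I : Set A}

/-- The elements of `A` which become small modulo `I` when localized at `φ`. -/
def localKernel (hI : IsIdealOf I Set.univ)
    (φ : characterSpace ℂ (Unitization ℂ (NonUnitalStarSubalgebra.center ℂ hI.Quotient))) :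
    Set A :=
  {x | ∀ ε > 0, ∃ f : NonUnitalStarSubalgebra.center ℂ hI.Quotient,
    φ (f : Unitization ℂ (NonUnitalStarSubalgebra.center ℂ hI.Quotient)) = 1 ∧ ‖f‖ ≤ 1 ∧
      ‖(f : hI.Quotient) * IsIdealOf.Quotient.mk hI x‖ ≤ ε}

lemma mem_localKernel {hI : IsIdealOf I Set.univ}
    {φ : characterSpace ℂ (Unitization ℂ (NonUnitalStarSubalgebra.center ℂ hI.Quotient))}
    (hφ : φ ≠ characterAtInfty) {c : NonUnitalStarSubalgebra.center ℂ hI.Quotient}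
    (hc : φ (c : Unitization ℂ (NonUnitalStarSubalgebra.center ℂ hI.Quotient)) = 0) {x : A}
    (hx : IsIdealOf.Quotient.mk hI x = c) : x ∈ localKernel hI φ := by
  intro ε hε
  obtain ⟨c₀, hc₀⟩ := exists_character_ne_zero hφ
  obtain ⟨f, h1, h2, h3⟩ := exists_localizer φ hc₀ hc hε
  exact ⟨f, h1, h2, by rw [hx]; exact h3⟩

lemma isIdealOf_localKernel {hI : IsIdealOf I Set.univ}
    {φ : characterSpace ℂ (Unitization ℂ (NonUnitalStarSubalgebra.center ℂ hI.Quotient))}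
    (hφ : φ ≠ characterAtInfty) : IsIdealOf (localKernel hI φ) Set.univ := by
  have hcomm (f : NonUnitalStarSubalgebra.center ℂ hI.Quotient) (q : hI.Quotient) :
      q * f = f * q := NonUnitalStarSubalgebra.mem_center_iff.1 f.2 q
  have hbound (f : NonUnitalStarSubalgebra.center ℂ hI.Quotient) (hf : ‖f‖ ≤ 1)
      (q : hI.Quotient) : ‖(f : hI.Quotient) * q‖ ≤ ‖q‖ :=
    (norm_mul_le _ _).trans (mul_le_of_le_one_left (norm_nonneg _) hf)
  refine ⟨Set.subset_univ _, ?_, ?_, ?_, ?_, ?_⟩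
  · refine isClosed_of_closure_subset fun x hx ε hε => ?_
    obtain ⟨y, hy, hxy⟩ := Metric.mem_closure_iff.1 hx (ε / 2) (half_pos hε)
    obtain ⟨f, h1, h2, h3⟩ := hy (ε / 2) (half_pos hε)
    refine ⟨f, h1, h2, ?_⟩
    rw [dist_eq_norm] at hxy
    have hsplit : (f : hI.Quotient) * IsIdealOf.Quotient.mk hI x =
        f * IsIdealOf.Quotient.mk hI (x - y) + f * IsIdealOf.Quotient.mk hI y := by
      rw [← mul_add, ← map_add, sub_add_cancel]
    have := hbound f h2 (IsIdealOf.Quotient.mk hI (x - y))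
    have := IsIdealOf.Quotient.norm_mk_le (hI := hI) (x - y)
    rw [hsplit]
    refine (norm_add_le _ _).trans ?_
    linarith
  · exact mem_localKernel hφ (c := 0) (by simp) (by simp)
  · intro x hx y hy ε hε
    obtain ⟨f, f1, f2, f3⟩ := hx (ε / 2) (half_pos hε)
    obtain ⟨g, g1, g2, g3⟩ := hy (ε / 2) (half_pos hε)
    refine ⟨f * g, by rw [inr_mul, map_mul, f1, g1, one_mul],
      (norm_mul_le _ _).trans (mul_le_one₀ f2 (norm_nonneg _) g2), ?_⟩
    have hsplit : ((f * g : NonUnitalStarSubalgebra.center ℂ hI.Quotient) : hI.Quotient) *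
        IsIdealOf.Quotient.mk hI (x + y) = g * (f * IsIdealOf.Quotient.mk hI x) +
          f * (g * IsIdealOf.Quotient.mk hI y) := by
      rw [← mul_assoc, ← mul_assoc, ← hcomm g f, ← mul_add, ← map_add]
      rfl
    rw [hsplit]
    refine (norm_add_le _ _).trans ?_
    have := hbound g g2 (f * IsIdealOf.Quotient.mk hI x)
    have := hbound f f2 (g * IsIdealOf.Quotient.mk hI y)
    linarith
  · intro x hx ε hε
    obtain ⟨f, h1, h2, h3⟩ := hx ε hε
    exact ⟨f, h1, h2, by rwa [map_neg, mul_neg, norm_neg]⟩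
  · intro x hx a _
    have hδ (ε : ℝ) (hε : 0 < ε) : ‖IsIdealOf.Quotient.mk hI a‖ *
        (ε / (‖IsIdealOf.Quotient.mk hI a‖ + 1)) ≤ ε := by
      have := norm_nonneg (IsIdealOf.Quotient.mk hI a)
      rw [← mul_div_assoc, div_le_iff₀ (by positivity)]
      nlinarith
    constructor <;> intro ε hε <;>
      obtain ⟨f, h1, h2, h3⟩ := hx (ε / (‖IsIdealOf.Quotient.mk hI a‖ + 1)) (by positivity)
    · refine ⟨f, h1, h2, ?_⟩
      rw [map_mul, ← mul_assoc, ← hcomm, mul_assoc]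
      exact (norm_mul_le _ _).trans (le_trans (by gcongr) (hδ ε hε))
    · refine ⟨f, h1, h2, ?_⟩
      rw [map_mul, ← mul_assoc]
      refine (norm_mul_le _ _).trans (le_trans ?_ (hδ ε hε))
      rw [mul_comm]
      gcongr

/-- Every character of the centre of `A / I` is the restriction of a modular maximal ideal. -/
lemma exists_modMax_of_character {hI : IsIdealOf I Set.univ}
    {φ : characterSpace ℂ (Unitization ℂ (NonUnitalStarSubalgebra.center ℂ hI.Quotient))}
    (hφ : φ ≠ characterAtInfty) :
    ∃ M, IsModMaxIdealOf M (Set.univ : Set A) ∧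
      ∀ (c : NonUnitalStarSubalgebra.center ℂ hI.Quotient) (x : A),
        IsIdealOf.Quotient.mk hI x = c →
          (x ∈ M ↔ φ (c : Unitization ℂ (NonUnitalStarSubalgebra.center ℂ hI.Quotient)) = 0) := by
  have hcomm (f : NonUnitalStarSubalgebra.center ℂ hI.Quotient) (q : hI.Quotient) :
      q * f = f * q := NonUnitalStarSubalgebra.mem_center_iff.1 f.2 q
  obtain ⟨c₀, hc₀⟩ := exists_character_ne_zero hφ
  obtain ⟨u, hu, hu1, -⟩ := exists_localizer φ hc₀ (n := 0) (by simp) one_pos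
  obtain ⟨e, he⟩ := IsIdealOf.Quotient.mk_surjective hI (u : hI.Quotient)
  have hunit : IsRelUnitMod Set.univ (localKernel hI φ) e := by
    have key (x : A) (ε : ℝ) (hε : 0 < ε) :
        ∃ f : NonUnitalStarSubalgebra.center ℂ hI.Quotient,
          φ (f : Unitization ℂ (NonUnitalStarSubalgebra.center ℂ hI.Quotient)) = 1 ∧ ‖f‖ ≤ 1 ∧
          ‖(f : hI.Quotient) * (IsIdealOf.Quotient.mk hI x - u * IsIdealOf.Quotient.mk hI x)‖
            ≤ ε := by
      have hpos : 0 < ‖IsIdealOf.Quotient.mk hI x‖ + 1 := by positivity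
      obtain ⟨f, h1, h2, h3⟩ := exists_localizer φ (c := u) (n := u - u * u) (by simp [hu])
        ((character_inr_sub φ _ _).trans (by rw [inr_mul, map_mul, hu, one_mul, sub_self]))
        (div_pos hε hpos)
      refine ⟨f * u, by rw [inr_mul, map_mul, h1, hu, one_mul],
        (norm_mul_le _ _).trans (mul_le_one₀ h2 (norm_nonneg _) hu1), ?_⟩
      have : ((f * u : NonUnitalStarSubalgebra.center ℂ hI.Quotient) : hI.Quotient) *
          (IsIdealOf.Quotient.mk hI x - u * IsIdealOf.Quotient.mk hI x) =
          ((f * (u - u * u) : NonUnitalStarSubalgebra.center ℂ hI.Quotient) : hI.Quotient) *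
            IsIdealOf.Quotient.mk hI x := by
        push_cast
        noncomm_ring
      rw [this]
      refine (norm_mul_le _ _).trans ?_
      calc _ ≤ ε / (‖IsIdealOf.Quotient.mk hI x‖ + 1) * (‖IsIdealOf.Quotient.mk hI x‖ + 1) := by
            gcongr
            · exact h3
            · linarith
        _ = ε := div_mul_cancel₀ _ hpos.ne'
    refine ⟨Set.mem_univ e, fun x _ => ⟨fun ε hε => ?_, fun ε hε => ?_⟩⟩
    · rw [map_sub, map_mul, he, hcomm]
      exact key x ε hε
    · rw [map_sub, map_mul, he]
      exact key x ε hε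
  have heK : e ∉ localKernel hI φ := by
    intro h
    obtain ⟨f, h1, -, h3⟩ := h (1 / 2) (by norm_num)
    rw [he] at h3
    have := norm_character_inr_le φ (f * u)
    rw [inr_mul, map_mul, h1, hu, one_mul, norm_one] at this
    have h4 : ‖f * u‖ ≤ 1 / 2 := h3
    linarith
  obtain ⟨M, hM, hKM, heM⟩ := (isIdealOf_localKernel hφ).exists_le_modMax hunit heK
  refine ⟨M, hM, fun c x hx => ⟨fun hxM => ?_, fun hc => hKM (mem_localKernel hφ hc hx)⟩⟩
  by_contra hc
  obtain ⟨y, hy⟩ := IsIdealOf.Quotient.mk_surjective hI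
    (((φ (c : Unitization ℂ _))⁻¹ • u : NonUnitalStarSubalgebra.center ℂ hI.Quotient) :
      hI.Quotient)
  refine heM ?_
  rw [← sub_add_cancel e (y * x)]
  refine hM.1.add_mem (hKM (mem_localKernel hφ (c := u - ((φ (c : Unitization ℂ _))⁻¹ • u) * c)
    ?_ ?_)) (hM.1.mul_left y hxM)
  · refine (character_inr_sub φ _ _).trans ?_
    rw [inr_mul, inr_smul, map_mul, map_smul, hu, smul_eq_mul, mul_one, inv_mul_cancel₀ hc,
      sub_self]
  · rw [map_sub, map_mul, he, hx, hy]
    rfl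

/-- A weakly central C⋆-algebra has the centre-quotient property. -/
theorem WeaklyCentral.hasCQ (h : WeaklyCentral (Set.univ : Set A)) :
    HasCQ (Set.univ : Set A) := by
  intro I hI a _ ha
  let C := NonUnitalStarSubalgebra.center ℂ hI.Quotient
  let π : NonUnitalStarSubalgebra.center ℂ A →⋆ₙₐ[ℂ] C :=
    NonUnitalStarAlgHom.codRestrict ((IsIdealOf.Quotient.mk hI).comp
      (NonUnitalStarSubalgebraClass.subtype (NonUnitalStarSubalgebra.center ℂ A))) C fun z => by
        refine NonUnitalStarSubalgebra.mem_center_iff.2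
          ((IsIdealOf.Quotient.mk_surjective hI).forall.2 fun x => ?_)
        show IsIdealOf.Quotient.mk hI x * IsIdealOf.Quotient.mk hI z =
          IsIdealOf.Quotient.mk hI z * IsIdealOf.Quotient.mk hI x
        rw [← map_mul, ← map_mul, NonUnitalStarSubalgebra.mem_center_iff.1 z.2 x]
  have hπ (z) : (π z : hI.Quotient) = IsIdealOf.Quotient.mk hI (z : A) := rfl
  have hπc : Continuous π :=
    Continuous.subtype_mk ((IsIdealOf.Quotient.continuous_mk hI).comp continuous_subtype_val) _
  let B : NonUnitalStarSubalgebra ℂ C := NonUnitalStarAlgHom.range π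
  have hBmem (z) : π z ∈ B := ⟨z, rfl⟩
  have hB : IsClosed (B : Set C) := by
    rw [NonUnitalStarAlgHom.coe_range]
    exact isClosed_range_starHom π hπc
  have hne : ∀ φ : characterSpace ℂ (Unitization ℂ C), φ ≠ characterAtInfty →
      ∃ b ∈ B, φ (b : Unitization ℂ C) ≠ 0 := by
    intro φ hφ
    obtain ⟨M, hM, hMφ⟩ := exists_modMax_of_character hφ
    obtain ⟨z, hz, hzM⟩ := Set.not_subset.1 (h.1 M hM)
    let z' : NonUnitalStarSubalgebra.center ℂ A := ⟨z, mem_centerOf_univ.1 hz⟩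
    exact ⟨π z', hBmem z', fun h0 => hzM ((hMφ (π z') z rfl).2 h0)⟩
  have hmk : IsIdealOf.Quotient.mk hI a ∈ C := by
    refine NonUnitalStarSubalgebra.mem_center_iff.2
      ((IsIdealOf.Quotient.mk_surjective hI).forall.2 fun x => ?_)
    rw [eq_comm, ← sub_eq_zero, ← map_mul, ← map_mul, ← map_sub, IsIdealOf.Quotient.mk_eq_zero]
    exact ha x (Set.mem_univ x)
  obtain ⟨z, hz⟩ : (⟨_, hmk⟩ : C) ∈ B := by
    refine eq_top_of_separates B hB hne (fun φ ψ hφ hψ hφψ => ?_) _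
    by_contra! hB_eq
    obtain ⟨M, hM, hMφ⟩ := exists_modMax_of_character hφ
    obtain ⟨N, hN, hNψ⟩ := exists_modMax_of_character hψ
    have hMN : M = N := by
      refine h.2 M N hM hN (Set.ext fun z => and_congr_left fun hz => ?_)
      let z' : NonUnitalStarSubalgebra.center ℂ A := ⟨z, mem_centerOf_univ.1 hz⟩
      rw [hMφ (π z') z rfl, hNψ (π z') z rfl, hB_eq _ (hBmem z')]
    have hker (c : C) : φ (c : Unitization ℂ C) = 0 ↔ ψ (c : Unitization ℂ C) = 0 := by
      obtain ⟨x, hx⟩ := IsIdealOf.Quotient.mk_surjective hI (c : hI.Quotient)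
      rw [← hMφ c x hx, ← hNψ c x hx, hMN]
    obtain ⟨b, hb, hφb⟩ := hne φ hφ
    refine hφψ (DFunLike.ext _ _ fun d => ?_)
    rw [character_apply φ, character_apply ψ]
    congr 1
    have := (hker (φ (b : Unitization ℂ C) • d.snd - φ (d.snd : Unitization ℂ C) • b)).1 (by
      refine (character_inr_sub φ _ _).trans ?_
      rw [inr_smul, inr_smul, map_smul, map_smul, smul_eq_mul, smul_eq_mul]
      ring)
    replace this := (character_inr_sub ψ _ _).symm.trans this
    rw [inr_smul, inr_smul, map_smul, map_smul, smul_eq_mul, smul_eq_mul,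
      ← hB_eq b hb, mul_comm (φ (d.snd : Unitization ℂ C)), ← mul_sub] at this
    exact (sub_eq_zero.1 ((mul_eq_zero.1 this).resolve_left hφb)).symm
  refine ⟨z, mem_centerOf_univ.2 z.2, ?_⟩
  rw [← IsIdealOf.Quotient.mk_eq_zero (hI := hI), map_sub, sub_eq_zero, ← hπ]
  exact congrArg Subtype.val hz.symm

end WeaklyCentral

section Restriction

variable {A : Type*} [NonUnitalCStarAlgebra A] {J : Set A}

/-- A closed ideal of a C⋆-algebra as a star subalgebra. -/
def IsIdealOf.toStarSubalgebra (hJ : IsIdealOf J Set.univ) : NonUnitalStarSubalgebra ℂ A where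
  carrier := J
  add_mem' := hJ.add_mem
  zero_mem' := hJ.2.2.1
  smul_mem' c _ hx := hJ.smul_mem c hx
  mul_mem' _ hy := hJ.mul_left _ hy
  star_mem' hx := hJ.star_mem hx

noncomputable instance (hJ : IsIdealOf J Set.univ) :
    NonUnitalCStarAlgebra hJ.toStarSubalgebra :=
  have : IsClosed (hJ.toStarSubalgebra : Set A) := hJ.2.1
  NonUnitalStarSubalgebra.nonUnitalCStarAlgebra hJ.toStarSubalgebra

/-- The centre of an ideal consists of central elements. -/
lemma IsIdealOf.commute_of_mem_centerOf (hJ : IsIdealOf J Set.univ) {w : A}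
    (hw : w ∈ centerOf J) (a : A) : w * a = a * w := by
  have hd : w * a - a * w ∈ J := hJ.sub_mem (hJ.mul_right a hw.1) (hJ.mul_left a hw.1)
  have hx (x : A) (hx : x ∈ J) : (w * a - a * w) * x = 0 := by
    rw [sub_mul, mul_assoc, mul_assoc, hw.2 _ (hJ.mul_left a hx), hw.2 x hx, mul_assoc, sub_self]
  exact sub_eq_zero.1 (CStarRing.mul_star_self_eq_zero_iff _ |>.1 (hx _ (hJ.star_mem hd)))

lemma IsIdealOf.coe_centerOf (hJ : IsIdealOf J Set.univ) (w : hJ.toStarSubalgebra) :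
    (w : A) ∈ centerOf J ↔ w ∈ centerOf (Set.univ : Set hJ.toStarSubalgebra) :=
  ⟨fun h => ⟨Set.mem_univ w, fun x _ => Subtype.ext (h.2 x x.2)⟩,
    fun h => ⟨w.2, fun x hx => congrArg Subtype.val (h.2 ⟨x, hx⟩ (Set.mem_univ _))⟩⟩

lemma IsIdealOf.image_coe (hJ : IsIdealOf J Set.univ) {M : Set hJ.toStarSubalgebra}
    (hM : IsIdealOf M Set.univ) : IsIdealOf ((↑) '' M : Set A) J := by
  have hcl : IsClosed (hJ.toStarSubalgebra : Set A) := hJ.2.1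
  refine ⟨?_, hcl.isClosedEmbedding_subtypeVal.isClosedMap _ hM.2.1, ⟨0, hM.2.2.1, rfl⟩, ?_, ?_, ?_⟩
  · rintro _ ⟨x, -, rfl⟩
    exact x.2
  · rintro _ ⟨x, hx, rfl⟩ _ ⟨y, hy, rfl⟩
    exact ⟨x + y, hM.add_mem hx hy, rfl⟩
  · rintro _ ⟨x, hx, rfl⟩
    exact ⟨-x, hM.neg_mem hx, rfl⟩
  · rintro _ ⟨x, hx, rfl⟩ a ha
    exact ⟨⟨_, hM.mul_left ⟨a, ha⟩ hx, rfl⟩, ⟨_, hM.mul_right ⟨a, ha⟩ hx, rfl⟩⟩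

lemma IsIdealOf.preimage_coe (hJ : IsIdealOf J Set.univ) {I : Set A} (hI : IsClosed I)
    (h0 : (0 : A) ∈ I) (hadd : ∀ x ∈ I, ∀ y ∈ I, x + y ∈ I) (hneg : ∀ x ∈ I, -x ∈ I)
    (hmul : ∀ x ∈ I, ∀ a ∈ J, a * x ∈ I ∧ x * a ∈ I) :
    IsIdealOf ((↑) ⁻¹' I : Set hJ.toStarSubalgebra) Set.univ :=
  ⟨Set.subset_univ _, hI.preimage continuous_subtype_val, h0, fun _ hx _ hy => hadd _ hx _ hy,
    fun _ hx => hneg _ hx, fun _ hx a _ => hmul _ hx a a.2⟩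

lemma IsIdealOf.isModMaxIdealOf_image_coe (hJ : IsIdealOf J Set.univ)
    {M : Set hJ.toStarSubalgebra} (hM : IsModMaxIdealOf M Set.univ) :
    IsModMaxIdealOf ((↑) '' M : Set A) J := by
  obtain ⟨hid, hne, hmax, e, -, he⟩ := hM
  have huniv : ((↑) '' (Set.univ : Set hJ.toStarSubalgebra) : Set A) = J := by
    rw [Set.image_univ]; exact Subtype.range_coe
  refine ⟨hJ.image_coe hid, fun h => hne ?_, fun I hI hMI => ?_, e, e.2, fun x hx => ?_⟩
  · exact Set.image_injective.2 Subtype.val_injective (h.trans huniv.symm)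
  · obtain ⟨hIJ, h1, h2, h3, h4, h5⟩ := hI
    have hI_eq : ((↑) '' ((↑) ⁻¹' I : Set hJ.toStarSubalgebra) : Set A) = I :=
      Set.image_preimage_eq_of_subset fun x hx => ⟨⟨x, hIJ hx⟩, rfl⟩
    refine (hmax _ (hJ.preimage_coe h1 h2 h3 h4 h5) (Set.image_subset_iff.1 hMI)).imp
      (fun h => ?_) (fun h => ?_)
    · rw [← hI_eq, h]
    · rw [← hI_eq, h, huniv]
  · have := he ⟨x, hx⟩ (Set.mem_univ _)
    exact ⟨⟨_, this.1, rfl⟩, ⟨_, this.2, rfl⟩⟩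

lemma IsIdealOf.weaklyCentral_coe (hJ : IsIdealOf J Set.univ) (h : WeaklyCentral J) :
    WeaklyCentral (Set.univ : Set hJ.toStarSubalgebra) := by
  refine ⟨fun M hM hZ => h.1 _ (hJ.isModMaxIdealOf_image_coe hM) fun w hw =>
    ⟨⟨w, hw.1⟩, hZ ((hJ.coe_centerOf _).1 hw), rfl⟩, fun M N hM hN hMN => ?_⟩
  refine Set.image_injective.2 Subtype.val_injective
    (h.2 _ _ (hJ.isModMaxIdealOf_image_coe hM) (hJ.isModMaxIdealOf_image_coe hN) ?_)
  ext w
  refine and_congr_left fun hw => ?_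
  have := Set.ext_iff.1 hMN ⟨w, hw.1⟩
  have hw' := (hJ.coe_centerOf ⟨w, hw.1⟩).1 hw
  simp only [Set.mem_inter_iff, hw', and_true] at this
  constructor
  · rintro ⟨x, hx, rfl⟩; exact ⟨x, this.1 hx, rfl⟩
  · rintro ⟨x, hx, rfl⟩; exact ⟨x, this.2 hx, rfl⟩

end Restriction

end CQP

/-- **Corollary 4.4.** If `A` is a C*-algebra, then `Z(A) + J_wc(A) ⊆ CQ(A)`. -/
theorem stmt13 {A : Type*} [NonUnitalCStarAlgebra A] (Jwc : Set A)
    (hJ : IsLargestWCIdealOf Jwc (Set.univ : Set A)) :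
    centerOf (Set.univ : Set A) + Jwc ⊆ CQset (Set.univ : Set A) := by
  rintro _ ⟨z, hz, j, hj, rfl⟩
  refine ⟨Set.mem_univ _, fun I hI hI_comm => ?_⟩
  have hJ' := hJ.1
  obtain ⟨w, hw, hjw⟩ := (hJ'.weaklyCentral_coe hJ.2.1).hasCQ _
    (hJ'.preimage_coe hI.2.1 hI.2.2.1 hI.2.2.2.1 hI.2.2.2.2.1
      fun x hx a _ => hI.2.2.2.2.2 x hx a (Set.mem_univ a)) ⟨j, hj⟩ (Set.mem_univ _)
    fun x _ => by
      have := hI_comm x (Set.mem_univ _)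
      rw [add_mul, mul_add, hz.2 x (Set.mem_univ _), add_sub_add_left_eq_sub] at this
      exact this
  have hw_comm := hJ'.commute_of_mem_centerOf ((hJ'.coe_centerOf w).2 hw)
  refine ⟨z + w, ⟨Set.mem_univ _, fun x hx => ?_⟩, ?_⟩
  · rw [add_mul, mul_add, hz.2 x hx, hw_comm]
  · rw [add_sub_add_left_eq_sub]
    exact hjw
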